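/- For every finite simple graph G of order n (not necessarily connected), both 2·ι_g(G) ≤ n and 2·ι_g'(G) ≤ n hold. -/

import Mathlib

open SimpleGraph

variable {V : Type*}

/-- The closed neighborhood `N_G[X]` of a set `X` of vertices: all vertices that are in `X`
or adjacent to a vertex of `X`. -/
def closedNbhdSet (G : SimpleGraph V) (X : Set V) : Set V :=
  {u | u ∈ X ∨ ∃ x ∈ X, G.Adj x u}

/-- A vertex `v` is playable with respect to the set `X` of already selected vertices if the
closed neighborhood of `v` contains a vertex `u ∉ N_G[X]` having a neighbor `w ∉ N_G[X]`,
i.e. `v` dominates a vertex of a nontrivial component of `G - N_G[X]`. -/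
def IsPlayable (G : SimpleGraph V) (X : Set V) (v : V) : Prop :=
  ∃ u, (u = v ∨ G.Adj v u) ∧ u ∉ closedNbhdSet G X ∧
    ∃ w, G.Adj u w ∧ w ∉ closedNbhdSet G X

open Classical in
/-- The optimal-play value (number of further selected vertices) of the isolation game
position with given fuel, player to move (`true` = Dominator, the minimizer;
`false` = Staller, the maximizer) and set `X` of already selected vertices. -/
noncomputable def isoGameVal (G : SimpleGraph V) : ℕ → Bool → Set V → ℕ
  | 0, _, _ => 0
  | (k + 1), isDom, X =>
    if ∃ v, IsPlayable G X v then
      (if isDom then sInf else sSup)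
        {n : ℕ | ∃ v, IsPlayable G X v ∧ n = isoGameVal G k (!isDom) (insert v X) + 1}
    else 0

/-- The game isolation number `ι_g(G)`: the number of vertices selected in the isolation
game on `G` when Dominator moves first and both players play optimally.  (A game on a
graph with `n` vertices lasts at most `n` moves, so fuel `Fintype.card V` suffices.) -/
noncomputable def iotaGame (G : SimpleGraph V) [Fintype V] : ℕ :=
  isoGameVal G (Fintype.card V) true ∅

/-- The Staller-start game isolation number `ι_g'(G)`: the number of vertices selected in
the isolation game on `G` when Staller moves first and both players play optimally. -/
noncomputable def iotaGame' (G : SimpleGraph V) [Fintype V] : ℕ :=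
  isoGameVal G (Fintype.card V) false ∅

lemma mem_closedNbhdSet_insert {G : SimpleGraph V} {X : Set V} {v u : V} :
    u ∈ closedNbhdSet G (insert v X) ↔ (u = v ∨ G.Adj v u) ∨ u ∈ closedNbhdSet G X := by
  simp only [closedNbhdSet, Set.mem_ofPred_eq, Set.mem_insert_iff, exists_eq_or_imp]
  tauto

/-- The vertices of the nontrivial components of `G - N_G[X]`. -/
def activeSet (G : SimpleGraph V) (X : Set V) : Set V :=
  {u | u ∉ closedNbhdSet G X ∧ ∃ w, G.Adj u w ∧ w ∉ closedNbhdSet G X}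

lemma mem_activeSet_of_adj {G : SimpleGraph V} {X : Set V} {u w : V} (h : G.Adj u w)
    (hu : u ∉ closedNbhdSet G X) (hw : w ∉ closedNbhdSet G X) : u ∈ activeSet G X :=
  ⟨hu, w, h, hw⟩

lemma isPlayable_of_mem_activeSet {G : SimpleGraph V} {X : Set V} {v : V}
    (h : v ∈ activeSet G X) : IsPlayable G X v :=
  ⟨v, Or.inl rfl, h⟩

lemma activeSet_insert_subset (G : SimpleGraph V) (X : Set V) (v : V) :
    activeSet G (insert v X) ⊆ activeSet G X := by
  rintro u ⟨hu, w, huw, hw⟩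
  rw [mem_closedNbhdSet_insert, not_or] at hu hw
  exact ⟨hu.2, w, huw, hw.2⟩

lemma notMem_activeSet_insert {G : SimpleGraph V} {X : Set V} {v u : V}
    (h : u = v ∨ G.Adj v u) : u ∉ activeSet G (insert v X) :=
  fun hu => hu.1 (mem_closedNbhdSet_insert.2 (Or.inl h))

lemma ncard_activeSet_insert_add_le [Finite V] {G : SimpleGraph V} {X : Set V} {v : V}
    (s : Finset V) (hs : ∀ u ∈ s, u ∈ activeSet G X ∧ u ∉ activeSet G (insert v X)) :
    (activeSet G (insert v X)).ncard + s.card ≤ (activeSet G X).ncard := by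
  have hd : Disjoint (activeSet G (insert v X)) (s : Set V) :=
    Set.disjoint_right.2 fun u hu => (hs u hu).2
  rw [← Set.ncard_coe_finset, ← Set.ncard_union_eq hd]
  exact Set.ncard_le_ncard
    (Set.union_subset (activeSet_insert_subset G X v) fun u hu => (hs u hu).1)

lemma ncard_activeSet_insert_add_one_le [Finite V] {G : SimpleGraph V} {X : Set V} {v : V}
    (h : IsPlayable G X v) :
    (activeSet G (insert v X)).ncard + 1 ≤ (activeSet G X).ncard := by
  obtain ⟨u, huv, hu⟩ := h
  simpa using ncard_activeSet_insert_add_le {u}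
    (by simpa using ⟨hu, notMem_activeSet_insert huv⟩)

/-- Every nontrivial component of `G - N_G[X]` is a single edge. -/
def IsMatchingPosition (G : SimpleGraph V) (X : Set V) : Prop :=
  ∀ u ∈ activeSet G X, ∀ x ∈ activeSet G X, ∀ y ∈ activeSet G X,
    G.Adj u x → G.Adj u y → x = y

lemma IsMatchingPosition.insert {G : SimpleGraph V} {X : Set V}
    (h : IsMatchingPosition G X) (v : V) : IsMatchingPosition G (insert v X) :=
  fun u hu x hx y hy =>
    have hsub := activeSet_insert_subset G X v
    h u (hsub hu) x (hsub hx) y (hsub hy)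

lemma IsMatchingPosition.ncard_activeSet_insert_add_two_le [Finite V] {G : SimpleGraph V}
    {X : Set V} {v : V} (h : IsMatchingPosition G X) (hv : IsPlayable G X v) :
    (activeSet G (Insert.insert v X)).ncard + 2 ≤ (activeSet G X).ncard := by
  classical
  obtain ⟨u, huv, hu, w, huw, hw⟩ := hv
  have hua : u ∈ activeSet G X := mem_activeSet_of_adj huw hu hw
  have hwa : w ∈ activeSet G X := mem_activeSet_of_adj huw.symm hw hu
  have hw' : w ∉ activeSet G (Insert.insert v X) := by
    rintro ⟨hw₁, z, hwz, hz⟩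
    have hza := activeSet_insert_subset G X v (mem_activeSet_of_adj hwz.symm hz hw₁)
    have huz : u = z := h w hwa u hua z hza huw.symm hwz
    exact hz (mem_closedNbhdSet_insert.2 (Or.inl (huz ▸ huv)))
  rw [← Finset.card_pair huw.ne]
  apply ncard_activeSet_insert_add_le
  simp only [Finset.mem_insert, Finset.mem_singleton]
  rintro _ (rfl | rfl)
  exacts [⟨hua, notMem_activeSet_insert huv⟩, ⟨hwa, hw'⟩]

lemma isoGameVal_false_le {G : SimpleGraph V} {k : ℕ} {X : Set V} {m : ℕ}
    (h : ∀ v, IsPlayable G X v → isoGameVal G k true (insert v X) + 1 ≤ m) :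
    isoGameVal G (k + 1) false X ≤ m := by
  by_cases hp : ∃ v, IsPlayable G X v
  · rw [isoGameVal, if_pos hp, if_neg Bool.false_ne_true]
    obtain ⟨v, hv⟩ := hp
    refine csSup_le ⟨_, v, hv, rfl⟩ ?_
    rintro _ ⟨w, hw, rfl⟩
    exact h w hw
  · simp [isoGameVal, hp]

lemma isoGameVal_true_le {G : SimpleGraph V} {k : ℕ} {X : Set V} {v : V}
    (hv : IsPlayable G X v) :
    isoGameVal G (k + 1) true X ≤ isoGameVal G k false (insert v X) + 1 := by
  rw [isoGameVal, if_pos ⟨v, hv⟩]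
  exact Nat.sInf_le ⟨v, hv, rfl⟩

lemma two_mul_isoGameVal_le [Finite V] (G : SimpleGraph V) (k : ℕ) (X : Set V) :
    2 * isoGameVal G k true X ≤ (activeSet G X).ncard ∧
      2 * isoGameVal G k false X ≤ (activeSet G X).ncard + 1 ∧
      (IsMatchingPosition G X → 2 * isoGameVal G k false X ≤ (activeSet G X).ncard) := by
  classical
  induction k generalizing X with
  | zero => simp [isoGameVal]
  | succ k ih =>
    refine ⟨?_, ?_, fun hX => ?_⟩
    · by_cases hX : IsMatchingPosition G X
      · by_cases hp : ∃ v, IsPlayable G X v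
        · obtain ⟨v, hv⟩ := hp
          have h₁ := isoGameVal_true_le (k := k) hv
          have h₂ := (ih (insert v X)).2.2 (hX.insert v)
          have h₃ := hX.ncard_activeSet_insert_add_two_le hv
          omega
        · simp [isoGameVal, hp]
      · simp only [IsMatchingPosition, not_forall] at hX
        obtain ⟨v, hv, x, hx, y, hy, hvx, hvy, hxy⟩ := hX
        have h₁ := isoGameVal_true_le (k := k) (isPlayable_of_mem_activeSet hv)
        have h₂ := (ih (insert v X)).2.1
        have h₃ : (activeSet G (insert v X)).ncard + 3 ≤ (activeSet G X).ncard := by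
          rw [← Finset.card_eq_three.2 ⟨v, x, y, hvx.ne, hvy.ne, hxy, rfl⟩]
          apply ncard_activeSet_insert_add_le
          simp only [Finset.mem_insert, Finset.mem_singleton]
          rintro _ (rfl | rfl | rfl)
          exacts [⟨hv, notMem_activeSet_insert (.inl rfl)⟩,
            ⟨hx, notMem_activeSet_insert (.inr hvx)⟩, ⟨hy, notMem_activeSet_insert (.inr hvy)⟩]
        omega
    · have h : isoGameVal G (k + 1) false X ≤ ((activeSet G X).ncard + 1) / 2 := by
        refine isoGameVal_false_le fun v hv => ?_
        have h₁ := (ih (insert v X)).1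
        have h₂ := ncard_activeSet_insert_add_one_le hv
        omega
      omega
    · have h : isoGameVal G (k + 1) false X ≤ (activeSet G X).ncard / 2 := by
        refine isoGameVal_false_le fun v hv => ?_
        have h₁ := (ih (insert v X)).1
        have h₂ := hX.ncard_activeSet_insert_add_two_le hv
        omega
      omega

lemma ncard_activeSet_singleton_add_two_le [Finite V] {G : SimpleGraph V} {v : V}
    (hv : IsPlayable G ∅ v) :
    (activeSet G (insert v ∅)).ncard + 2 ≤ (activeSet G ∅).ncard := by
  classical
  have hmem (u : V) : u ∉ closedNbhdSet G ∅ := by simp [closedNbhdSet]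
  obtain ⟨w, hvw⟩ : ∃ w, G.Adj v w := by
    obtain ⟨u, rfl | huv, -, w, huw, -⟩ := hv
    exacts [⟨w, huw⟩, ⟨u, huv⟩]
  rw [← Finset.card_pair hvw.ne]
  apply ncard_activeSet_insert_add_le
  simp only [Finset.mem_insert, Finset.mem_singleton]
  rintro _ (rfl | rfl)
  exacts [⟨mem_activeSet_of_adj hvw (hmem _) (hmem _), notMem_activeSet_insert (.inl rfl)⟩,
    ⟨mem_activeSet_of_adj hvw.symm (hmem _) (hmem _), notMem_activeSet_insert (.inr hvw)⟩]

/-- Remark 3.3: for every finite graph `G` of order `n` (not necessarily connected),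
both `ι_g(G) ≤ n/2` and `ι_g'(G) ≤ n/2` hold. -/
theorem game_isolation_half_bound_general {V : Type*} [Fintype V] (G : SimpleGraph V) :
    2 * iotaGame G ≤ Fintype.card V ∧ 2 * iotaGame' G ≤ Fintype.card V := by
  have hcard : (activeSet G ∅).ncard ≤ Fintype.card V := by
    rw [← Nat.card_eq_fintype_card]
    exact Set.ncard_le_card _
  refine ⟨(two_mul_isoGameVal_le G _ ∅).1.trans hcard, ?_⟩
  rw [iotaGame']
  rcases hn : Fintype.card V with _ | k
  · simp [isoGameVal]
  · have h : isoGameVal G (k + 1) false ∅ ≤ (k + 1) / 2 := by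
      refine isoGameVal_false_le fun v hv => ?_
      have h₁ := (two_mul_isoGameVal_le G k (insert v ∅)).1
      have h₂ := ncard_activeSet_singleton_add_two_le hv
      omega
    omega
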